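/- arXiv:1009.5535 — 2 statements merged into one kernel-verified Lean document; each statement's English description precedes it below -/
import Mathlib

section
/- Let X be a real Banach space and let (A_n) be an approximation scheme in X satisfying Shapiro's Theorem. Let Y be a linear subspace of X of finite codimension (not necessarily closed). Then Y satisfies Shapiro's Theorem relative to (A_n): for every nonincreasing sequence of nonnegative reals ε_n → 0 there exists y ∈ Y such that there is no constant C with E(y,A_n) ≤ C ε_n for all n. -/
open Metric Filter Pointwise

/-- `(A, K)` is an approximation scheme on `X`: the sets `A n` form a strictly increasing
chain, `A n + A n ⊆ A (K n)` with `K n ≥ n`, each `A n` is closed under scalar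
multiplication, and `⋃ n, A n` is dense in `X`. -/
def IsApproximationScheme {X : Type*} [NormedAddCommGroup X] [NormedSpace ℝ X]
    (A : ℕ → Set X) (K : ℕ → ℕ) : Prop :=
  (∀ n, A n ⊂ A (n + 1)) ∧
  (∀ n, n ≤ K n ∧ A n + A n ⊆ A (K n)) ∧
  (∀ (n : ℕ) (c : ℝ), c • A n ⊆ A n) ∧
  Dense (⋃ n, A n)

/-- Admissible error sequences: nonnegative, nonincreasing, tending to `0`. -/
def NullSeq (ε : ℕ → ℝ) : Prop :=
  (∀ n, 0 ≤ ε n) ∧ Antitone ε ∧ Tendsto ε atTop (nhds 0)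

/-- Some null sequence dominates, up to constants, the errors of all elements of `Y`. -/
def HasCommonRate {X : Type*} [NormedAddCommGroup X] [NormedSpace ℝ X]
    (A : ℕ → Set X) (Y : Submodule ℝ X) : Prop :=
  ∃ ε : ℕ → ℝ, NullSeq ε ∧ ∀ y ∈ Y, (fun n => infDist y (A n)) =O[atTop] ε

theorem NullSeq.add {ε δ : ℕ → ℝ} (hε : NullSeq ε) (hδ : NullSeq δ) :
    NullSeq fun n => ε n + δ n :=
  ⟨fun n => add_nonneg (hε.1 n) (hδ.1 n), hε.2.1.add hδ.2.1, by
    simpa using hε.2.2.add hδ.2.2⟩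

theorem NullSeq.comp {ε : ℕ → ℝ} {ν : ℕ → ℕ} (hε : NullSeq ε) (hν : Monotone ν)
    (hν' : Tendsto ν atTop atTop) : NullSeq fun n => ε (ν n) :=
  ⟨fun _ => hε.1 _, fun _ _ h => hε.2.1 (hν h), hε.2.2.comp hν'⟩

theorem nullSeq_one_div_add_one : NullSeq fun n => 1 / ((n : ℝ) + 1) :=
  ⟨fun _ => by positivity, fun _ _ h => by dsimp only; gcongr,
    tendsto_one_div_add_atTop_nhds_zero_nat⟩

/-- Every self-map of `ℕ` has a slowly growing generalized left inverse. -/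
theorem exists_monotone_tendsto_eventually_comp_le (K : ℕ → ℕ) :
    ∃ ν : ℕ → ℕ, Monotone ν ∧ Tendsto ν atTop atTop ∧ ∀ᶠ m in atTop, K (ν m) ≤ m := by
  refine ⟨fun m => Nat.findGreatest (fun n => K n ≤ m) m, ?_, ?_, ?_⟩
  · intro a b hab
    exact Nat.findGreatest_mono (fun n hn => le_trans hn hab) hab
  · refine tendsto_atTop.2 fun b => ?_
    filter_upwards [eventually_ge_atTop b, eventually_ge_atTop (K b)] with m h₁ h₂
    exact Nat.le_findGreatest h₁ h₂
  · filter_upwards [eventually_ge_atTop (K 0)] with m hm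
    exact Nat.findGreatest_spec (P := fun n => K n ≤ m) (Nat.zero_le m) hm

theorem infDist_add_le_of_add_subset {X : Type*} [SeminormedAddCommGroup X]
    {S T U : Set X} (hS : S.Nonempty) (hT : T.Nonempty) (h : S + T ⊆ U) (x y : X) :
    infDist (x + y) U ≤ infDist x S + infDist y T := by
  refine le_of_forall_pos_lt_add fun r hr => ?_
  obtain ⟨a, ha, hxa⟩ := (infDist_lt_iff (x := x) hS).1 (lt_add_of_pos_right _ (half_pos hr))
  obtain ⟨b, hb, hyb⟩ := (infDist_lt_iff (x := y) hT).1 (lt_add_of_pos_right _ (half_pos hr))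
  have h₁ := infDist_le_dist_of_mem (x := x + y) (h (Set.add_mem_add ha hb))
  have h₂ := dist_add_add_le x y a b
  linarith

theorem infDist_smul_le_of_smul_subset {X : Type*} [SeminormedAddCommGroup X] [NormedSpace ℝ X]
    {S : Set X} (c : ℝ) (h : c • S ⊆ S) (x : X) :
    infDist (c • x) S ≤ |c| * infDist x S := by
  rcases S.eq_empty_or_nonempty with rfl | hS
  · simp
  rcases eq_or_ne c 0 with rfl | hc
  · obtain ⟨s, hs⟩ := hS
    have h0 : (0 : X) ∈ S := h ⟨s, hs, by simp⟩
    simp [infDist_zero_of_mem h0]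
  · rw [← Real.norm_eq_abs, ← infDist_smul₀ hc]
    exact infDist_le_infDist_of_subset h hS.smul_set

section

variable {X : Type*} [NormedAddCommGroup X] [NormedSpace ℝ X] {A : ℕ → Set X} {K : ℕ → ℕ}

theorem IsApproximationScheme.monotone (hA : IsApproximationScheme A K) : Monotone A :=
  monotone_nat_of_le_succ fun n => (hA.1 n).subset

theorem IsApproximationScheme.nonempty_succ (hA : IsApproximationScheme A K) (n : ℕ) :
    (A (n + 1)).Nonempty :=
  (Set.nonempty_of_ssubset (hA.1 n)).mono Set.sdiff_subset

theorem IsApproximationScheme.nonempty (hA : IsApproximationScheme A K) {n : ℕ} (hn : 1 ≤ n) :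
    (A n).Nonempty := by
  obtain ⟨m, rfl⟩ := Nat.exists_eq_add_of_le' hn
  exact hA.nonempty_succ m

theorem IsApproximationScheme.nullSeq_infDist_succ (hA : IsApproximationScheme A K) (x : X) :
    NullSeq fun n => infDist x (A (n + 1)) := by
  have hanti : Antitone fun n => infDist x (A (n + 1)) := fun a b hab =>
    infDist_le_infDist_of_subset (hA.monotone (by omega)) (hA.nonempty_succ a)
  refine ⟨fun n => infDist_nonneg, hanti, ?_⟩
  refine Metric.tendsto_atTop.2 fun r hr => ?_
  obtain ⟨a, ha, hxa⟩ := hA.2.2.2.exists_dist_lt x hr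
  obtain ⟨N, hN⟩ := Set.mem_iUnion.1 ha
  refine ⟨N, fun n hn => ?_⟩
  rw [Real.dist_0_eq_abs, abs_of_nonneg infDist_nonneg]
  exact (infDist_le_dist_of_mem (hA.monotone (by omega) hN)).trans_lt hxa

theorem HasCommonRate.span_singleton (hA : IsApproximationScheme A K) (x : X) :
    HasCommonRate A (Submodule.span ℝ {x}) := by
  refine ⟨fun n => infDist x (A (n - 1 + 1)), (hA.nullSeq_infDist_succ x).comp
    (fun _ _ h => Nat.sub_le_sub_right h 1) (tendsto_sub_atTop_nat 1), fun y hy => ?_⟩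
  obtain ⟨c, rfl⟩ := Submodule.mem_span_singleton.1 hy
  refine Asymptotics.IsBigO.of_bound |c| ?_
  filter_upwards [eventually_ge_atTop 1] with n hn
  rw [Nat.sub_add_cancel hn, Real.norm_of_nonneg infDist_nonneg,
    Real.norm_of_nonneg infDist_nonneg]
  exact infDist_smul_le_of_smul_subset c (hA.2.2.1 n c) x

theorem HasCommonRate.sup (hA : IsApproximationScheme A K) {Y Z : Submodule ℝ X}
    (hY : HasCommonRate A Y) (hZ : HasCommonRate A Z) : HasCommonRate A (Y ⊔ Z) := by
  obtain ⟨ε, hε, hYε⟩ := hY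
  obtain ⟨δ, hδ, hZδ⟩ := hZ
  obtain ⟨ν, hν, hν', hKν⟩ := exists_monotone_tendsto_eventually_comp_le K
  refine ⟨_, (hε.add hδ).comp hν hν', fun x hx => ?_⟩
  obtain ⟨y, hy, z, hz, rfl⟩ := Submodule.mem_sup.1 hx
  have hεO : ε =O[atTop] fun n => ε n + δ n := .of_norm_le fun n => by
    rw [Real.norm_of_nonneg (hε.1 n)]
    exact le_add_of_nonneg_right (hδ.1 n)
  have hδO : δ =O[atTop] fun n => ε n + δ n := .of_norm_le fun n => by
    rw [Real.norm_of_nonneg (hδ.1 n)]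
    exact le_add_of_nonneg_left (hε.1 n)
  have hsum := (((hYε y hy).trans hεO).add ((hZδ z hz).trans hδO)).comp_tendsto hν'
  refine Asymptotics.IsBigO.trans (.of_bound' ?_) hsum
  filter_upwards [hKν, hν'.eventually_ge_atTop 1] with m hm hm'
  have hne := hA.nonempty hm'
  refine (Real.norm_of_nonneg infDist_nonneg).trans_le (le_trans ?_ (Real.le_norm_self _))
  exact infDist_add_le_of_add_subset hne hne
    ((hA.2.1 _).2.trans (hA.monotone hm)) y z

theorem HasCommonRate.of_fg (hA : IsApproximationScheme A K) {W : Submodule ℝ X} (hW : W.FG) :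
    HasCommonRate A W :=
  Submodule.fg_induction (motive := fun N _ => HasCommonRate A N)
    (HasCommonRate.span_singleton hA) (fun _ _ _ _ h₁ h₂ => h₁.sup hA h₂) W hW

/-- A common rate on the whole space contradicts Shapiro's Theorem. -/
theorem HasCommonRate.exists_bound_of_top (h : HasCommonRate A ⊤) :
    ∃ ε, NullSeq ε ∧ ∀ x : X, ∃ C : ℝ, ∀ n, infDist x (A n) ≤ C * ε n := by
  obtain ⟨ε, hε, h⟩ := h
  have hpos : ∀ n : ℕ, 0 < ε n + 1 / ((n : ℝ) + 1) := fun n =>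
    add_pos_of_nonneg_of_pos (hε.1 n) (by positivity)
  refine ⟨_, hε.add nullSeq_one_div_add_one, fun x => ?_⟩
  have hO : (fun n => infDist x (A n)) =O[atTop] fun n : ℕ => ε n + 1 / ((n : ℝ) + 1) :=
    (h x trivial).trans <| .of_norm_le fun n => by
      rw [Real.norm_of_nonneg (hε.1 n)]
      exact le_add_of_nonneg_right (by positivity)
  obtain ⟨C, -, hC⟩ := Asymptotics.bound_of_isBigO_nat_atTop hO
  refine ⟨C, fun n => ?_⟩
  have := hC (hpos n).ne'
  rwa [Real.norm_of_nonneg infDist_nonneg, Real.norm_of_nonneg (hpos n).le] at this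

end

/-- If an approximation scheme `(A n)` in a Banach space `X` satisfies Shapiro's Theorem,
then every (not necessarily closed) finite codimensional subspace `Y` of `X` satisfies
Shapiro's Theorem relative to `(A n)`. -/
theorem fin_codim_shapiro
    {X : Type*} [NormedAddCommGroup X] [NormedSpace ℝ X] [CompleteSpace X]
    (A : ℕ → Set X) (K : ℕ → ℕ) (hA : IsApproximationScheme A K)
    (hShap : ∀ ε : ℕ → ℝ, NullSeq ε →
      ∃ x : X, ¬ ∃ C : ℝ, ∀ n : ℕ, infDist x (A n) ≤ C * ε n)
    (Y : Submodule ℝ X) (hcodim : FiniteDimensional ℝ (X ⧸ Y)) :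
    ∀ ε : ℕ → ℝ, NullSeq ε →
      ∃ y ∈ Y, ¬ ∃ C : ℝ, ∀ n : ℕ, infDist y (A n) ≤ C * ε n := by
  intro ε hε
  by_contra! hY
  have hYrate : HasCommonRate A Y := ⟨ε, hε, fun y hy => by
    obtain ⟨C, hC⟩ := hY y hy
    refine .of_bound C (.of_forall fun n => ?_)
    rw [Real.norm_of_nonneg infDist_nonneg, Real.norm_of_nonneg (hε.1 n)]
    exact hC n⟩
  obtain ⟨W, hW⟩ := Y.exists_isCompl
  have : FiniteDimensional ℝ W := (Y.quotientEquivOfIsCompl W hW).finiteDimensional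
  have hWrate := HasCommonRate.of_fg hA (Module.Finite.iff_fg.1 this)
  have htop := hYrate.sup hA hWrate
  rw [hW.sup_eq_top] at htop
  obtain ⟨δ, hδ, hbound⟩ := htop.exists_bound_of_top
  obtain ⟨x, hx⟩ := hShap δ hδ
  exact hx (hbound x)
end

section
/- Let X be a real Banach space, let {0} = A_0 ⊆ A_1 ⊆ A_2 ⊆ ⋯ be an increasing sequence of finite dimensional linear subspaces of X, let Y be an infinite dimensional closed linear subspace of X, and let ε_0 ≥ ε_1 ≥ ε_2 ≥ ⋯ ≥ 0 be a nonincreasing sequence tending to 0. Then there exists y ∈ Y such that ‖y‖ = ε_0 and E(y, A_n) ≥ ε_n for every n ≥ 0. -/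
open Metric Filter Pointwise

/-! ### Mod 2 chains of ordered tuples -/

/-- Mod 2 chains spanned by the finite tuples of points of `V`. -/
abbrev TupleChain (V : Type*) := List V →₀ ZMod 2

namespace TupleChain

variable {V W : Type*}

/-- Prepend a vertex to every tuple of a chain. -/
noncomputable def cone (v : V) : TupleChain V →ₗ[ZMod 2] TupleChain V :=
  Finsupp.lmapDomain (ZMod 2) (ZMod 2) (List.cons v)

/-- Apply a map to all vertices of a chain. -/
noncomputable def push (h : V → W) : TupleChain V →ₗ[ZMod 2] TupleChain W :=
  Finsupp.lmapDomain (ZMod 2) (ZMod 2) (List.map h)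

/-- The (augmented) mod 2 boundary of a tuple. -/
noncomputable def listBoundary : List V → TupleChain V
  | [] => 0
  | v :: l => Finsupp.single l 1 + cone v (listBoundary l)

/-- The (augmented) mod 2 boundary operator. -/
noncomputable def boundary : TupleChain V →ₗ[ZMod 2] TupleChain V :=
  Finsupp.linearCombination (ZMod 2) listBoundary

/-- The prism over a tuple, with bottom given by `f` and top given by `g`. -/
noncomputable def listPrism (f g : V → W) : List V → TupleChain W
  | [] => 0
  | v :: l => Finsupp.single (f v :: g v :: l.map g) 1 + cone (f v) (listPrism f g l)

/-- The prism operator between `f` and `g`. -/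
noncomputable def prism (f g : V → W) : TupleChain V →ₗ[ZMod 2] TupleChain W :=
  Finsupp.linearCombination (ZMod 2) (listPrism f g)

@[simp] lemma cone_single (v : V) (l : List V) (r : ZMod 2) :
    cone v (Finsupp.single l r) = Finsupp.single (v :: l) r := by
  simp [cone]

@[simp] lemma push_single (h : V → W) (l : List V) (r : ZMod 2) :
    push h (Finsupp.single l r) = Finsupp.single (l.map h) r := by
  simp [push]

@[simp] lemma boundary_single (l : List V) :
    boundary (Finsupp.single l 1) = listBoundary l := by
  simp [boundary]

@[simp] lemma prism_single (h h' : V → W) (l : List V) :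
    prism h h' (Finsupp.single l 1) = listPrism h h' l := by
  simp [prism]

lemma add_self (c : TupleChain V) : c + c = 0 := ZModModule.add_self c

lemma hom_ext {M : Type*} [AddCommGroup M] [Module (ZMod 2) M]
    {f g : TupleChain V →ₗ[ZMod 2] M}
    (h : ∀ l, f (Finsupp.single l 1) = g (Finsupp.single l 1)) : f = g := by
  refine Finsupp.lhom_ext' fun l => LinearMap.ext_ring ?_
  simpa using h l

lemma push_push {U : Type*} (g : W → U) (h : V → W) (c : TupleChain V) :
    push g (push h c) = push (g ∘ h) c := by
  refine LinearMap.congr_fun (f := (push g).comp (push h)) (hom_ext fun l => ?_) c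
  simp

lemma push_id (c : TupleChain V) : push id c = c := by
  refine LinearMap.congr_fun (g := LinearMap.id) (hom_ext fun l => ?_) c
  simp

lemma push_cone (h : V → W) (v : V) (c : TupleChain V) :
    push h (cone v c) = cone (h v) (push h c) := by
  refine LinearMap.congr_fun (f := (push h).comp (cone v)) (g := (cone (h v)).comp (push h))
    (hom_ext fun l => ?_) c
  simp

lemma boundary_cone (v : V) (c : TupleChain V) :
    boundary (cone v c) = c + cone v (boundary c) := by
  refine LinearMap.congr_fun (f := boundary.comp (cone v))
    (g := LinearMap.id + (cone v).comp boundary) (hom_ext fun l => ?_) c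
  simp [listBoundary]

lemma boundary_boundary (c : TupleChain V) : boundary (boundary c) = 0 := by
  refine LinearMap.congr_fun (f := boundary.comp boundary) (g := 0) (hom_ext fun l => ?_) c
  simp only [LinearMap.comp_apply, boundary_single, LinearMap.zero_apply]
  induction l with
  | nil => simp [listBoundary]
  | cons v l ih => simp [listBoundary, boundary_cone, ih, add_self]

lemma boundary_push (h : V → W) (c : TupleChain V) :
    boundary (push h c) = push h (boundary c) := by
  refine LinearMap.congr_fun (f := boundary.comp (push h)) (g := (push h).comp boundary)
    (hom_ext fun l => ?_) c
  simp only [LinearMap.comp_apply, boundary_single, push_single]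
  induction l with
  | nil => simp [listBoundary]
  | cons v l ih => simp [listBoundary, push_cone, ih]

lemma prism_cone (h h' : V → W) (v : V) (c : TupleChain V) :
    prism h h' (cone v c) = cone (h v) (cone (h' v) (push h' c)) + cone (h v) (prism h h' c) := by
  refine LinearMap.congr_fun (f := (prism h h').comp (cone v))
    (g := (cone (h v)).comp ((cone (h' v)).comp (push h')) + (cone (h v)).comp (prism h h'))
    (hom_ext fun l => ?_) c
  simp [listPrism]

lemma boundary_prism (h h' : V → W) (c : TupleChain V) :
    boundary (prism h h' c) = push h' c + push h c + prism h h' (boundary c) := by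
  refine LinearMap.congr_fun (f := boundary.comp (prism h h'))
    (g := push h' + push h + (prism h h').comp boundary) (hom_ext fun l => ?_) c
  simp only [LinearMap.comp_apply, LinearMap.add_apply, boundary_single, push_single, prism_single]
  induction l with
  | nil => simp [listPrism, listBoundary, add_self]
  | cons v l ih =>
    have hb : listBoundary (l.map h') = push h' (listBoundary l) := by
      rw [← boundary_single, ← push_single, boundary_push, boundary_single]
    simp only [listPrism, listBoundary, map_add, boundary_single, boundary_cone, ih, prism_single,
      prism_cone, cone_single, List.map_cons, hb]
    generalize cone (h v) (cone (h' v) (push h' (listBoundary l))) = p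
    generalize cone (h v) (prism h h' (listBoundary l)) = q
    generalize listPrism h h' l = r
    have h1 := add_self (Finsupp.single (h v :: l.map h') (1 : ZMod 2))
    generalize Finsupp.single (h v :: l.map h') (1 : ZMod 2) = u at *
    generalize Finsupp.single (h' v :: l.map h') (1 : ZMod 2) = u' at *
    generalize Finsupp.single (h v :: l.map h) (1 : ZMod 2) = u'' at *
    linear_combination (norm := module) h1

/-- The coefficient of the empty tuple. -/
noncomputable def augmentation : TupleChain V →ₗ[ZMod 2] ZMod 2 := Finsupp.lapply []

/-- The cochain `l ↦ θ (head l) * φ l`. -/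
noncomputable def twist (θ : V → ZMod 2) (φ : TupleChain V →ₗ[ZMod 2] ZMod 2) :
    TupleChain V →ₗ[ZMod 2] ZMod 2 :=
  Finsupp.linearCombination (ZMod 2) fun l =>
    match l with
    | [] => 0
    | v :: t => θ v * φ (Finsupp.single (v :: t) 1)

/-- The cup product of the coboundaries of `θ 0, …, θ (k - 1)`. -/
noncomputable def cup (θ : ℕ → V → ZMod 2) : ℕ → TupleChain V →ₗ[ZMod 2] ZMod 2
  | 0 => augmentation.comp boundary
  | k + 1 => (twist (θ k) (cup θ k)).comp boundary

lemma cup_boundary (θ : ℕ → V → ZMod 2) (k : ℕ) (c : TupleChain V) :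
    cup θ k (boundary c) = 0 := by
  cases k <;> simp [cup, boundary_boundary]

lemma twist_cone (θ : V → ZMod 2) (φ : TupleChain V →ₗ[ZMod 2] ZMod 2) (v : V)
    (c : TupleChain V) : twist θ φ (cone v c) = θ v * φ (cone v c) := by
  refine LinearMap.congr_fun (f := (twist θ φ).comp (cone v)) (g := θ v • φ.comp (cone v))
    (hom_ext fun l => ?_) c
  simp [twist]

lemma cup_nil (θ : ℕ → V → ZMod 2) (k : ℕ) : cup θ k (Finsupp.single [] 1) = 0 := by
  cases k <;> simp [cup, listBoundary]

lemma cup_zero_singleton (θ : ℕ → V → ZMod 2) (v : V) :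
    cup θ 0 (Finsupp.single [v] 1) = 1 := by
  simp [cup, listBoundary, augmentation]

lemma cup_zero_cons_cons (θ : ℕ → V → ZMod 2) (v w : V) (l : List V) :
    cup θ 0 (Finsupp.single (v :: w :: l) 1) = 0 := by
  have key : ∀ c : TupleChain V, augmentation (cone v c) = 0 := fun c => by
    refine LinearMap.congr_fun (f := augmentation.comp (cone v)) (g := 0) (hom_ext fun l => ?_) c
    simp [augmentation]
  simp only [cup, LinearMap.comp_apply, boundary_single, listBoundary.eq_2 v, map_add, key]
  simp [augmentation]

lemma cup_succ_singleton (θ : ℕ → V → ZMod 2) (k : ℕ) (v : V) :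
    cup θ (k + 1) (Finsupp.single [v] 1) = 0 := by
  simp [cup, listBoundary, twist]

lemma cup_succ_cons_cons (θ : ℕ → V → ZMod 2) (k : ℕ) (v w : V) (l : List V) :
    cup θ (k + 1) (Finsupp.single (v :: w :: l) 1)
      = (θ k v + θ k w) * cup θ k (Finsupp.single (w :: l) 1) := by
  have h := cup_boundary θ k (Finsupp.single (v :: w :: l) 1)
  rw [boundary_single, listBoundary, map_add] at h
  rw [cup, LinearMap.comp_apply, boundary_single, listBoundary, map_add, twist_cone,
    ← cone_single, twist_cone, cone_single]
  have h' := CharTwo.add_self_eq_zero (cup θ k (Finsupp.single (w :: l) 1))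
  linear_combination θ k v * h - θ k v * h'

lemma map_eq_of_mem_supported {M : Type*} [AddCommGroup M] [Module (ZMod 2) M]
    {f g : TupleChain V →ₗ[ZMod 2] M} {s : Set (List V)} {c : TupleChain V}
    (hc : c ∈ Finsupp.supported (ZMod 2) (ZMod 2) s)
    (h : ∀ l ∈ s, f (Finsupp.single l 1) = g (Finsupp.single l 1)) : f c = g c := by
  rw [Finsupp.supported_eq_span_single] at hc
  refine LinearMap.eqOn_span (s := (fun l => Finsupp.single l (1 : ZMod 2)) '' s) ?_ hc
  rintro _ ⟨l, hl, rfl⟩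
  exact h l hl

lemma map_mem_supported {f : TupleChain V →ₗ[ZMod 2] TupleChain W} {s : Set (List V)}
    {t : Set (List W)} {c : TupleChain V}
    (hc : c ∈ Finsupp.supported (ZMod 2) (ZMod 2) s)
    (h : ∀ l ∈ s, f (Finsupp.single l 1) ∈ Finsupp.supported (ZMod 2) (ZMod 2) t) :
    f c ∈ Finsupp.supported (ZMod 2) (ZMod 2) t := by
  rw [Finsupp.supported_eq_span_single (ZMod 2) s] at hc
  refine (Submodule.span_le (p := (Finsupp.supported (ZMod 2) (ZMod 2) t).comap f)).2 ?_ hc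
  rintro _ ⟨l, hl, rfl⟩
  exact h l hl

lemma listPrism_mem_supported (h h' : V → W) (l : List V) :
    listPrism h h' l ∈ Finsupp.supported (ZMod 2) (ZMod 2)
      {t | ∀ x ∈ t, ∃ v ∈ l, x = h v ∨ x = h' v} := by
  induction l with
  | nil => exact Submodule.zero_mem _
  | cons v l ih =>
    refine Submodule.add_mem _ (Finsupp.single_mem_supported _ _ ?_) (map_mem_supported ih ?_)
    · simp only [Set.mem_ofPred_eq, List.mem_cons, List.mem_map]
      rintro x (rfl | rfl | ⟨w, hw, rfl⟩)
      exacts [⟨v, .inl rfl, .inl rfl⟩, ⟨v, .inl rfl, .inr rfl⟩, ⟨w, .inr hw, .inr rfl⟩]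
    · intro t ht
      rw [cone_single]
      refine Finsupp.single_mem_supported _ _ ?_
      simp only [Set.mem_ofPred_eq, List.mem_cons] at ht ⊢
      rintro x (rfl | hx)
      · exact ⟨v, .inl rfl, .inl rfl⟩
      · obtain ⟨w, hw, hxw⟩ := ht x hx
        exact ⟨w, .inr hw, hxw⟩

/-- If some factor is constant on a tuple then the cup product vanishes on it. -/
lemma cup_single_eq_zero (θ : ℕ → V → ZMod 2) {k i : ℕ} (hi : i < k) {l : List V}
    (hl : ∀ x ∈ l, ∀ y ∈ l, θ i x = θ i y) : cup θ k (Finsupp.single l 1) = 0 := by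
  induction k generalizing l with
  | zero => omega
  | succ k ih =>
    match l with
    | [] => exact cup_nil θ _
    | [v] => exact cup_succ_singleton θ k v
    | v :: w :: l =>
      rw [cup_succ_cons_cons]
      rcases Nat.lt_succ_iff_lt_or_eq.1 hi with hi | rfl
      · rw [ih hi fun x hx y hy => hl x (.tail _ hx) y (.tail _ hy), mul_zero]
      · rw [hl v (by simp) w (by simp), CharTwo.add_self_eq_zero, zero_mul]

lemma cup_single_map (θ : ℕ → V → ZMod 2) (a : V → V) {k : ℕ} {l : List V}
    (ha : ∀ i, ∀ x ∈ l, θ i (a x) = θ i x + 1) :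
    cup θ k (Finsupp.single (l.map a) 1) = cup θ k (Finsupp.single l 1) := by
  induction k generalizing l with
  | zero =>
    match l with
    | [] => rfl
    | [v] => simp [cup_zero_singleton]
    | v :: w :: l => simp [cup_zero_cons_cons]
  | succ k ih =>
    match l with
    | [] => rfl
    | [v] => simp [cup_succ_singleton]
    | v :: w :: l =>
      have h1 := ih fun i x hx => ha i x (.tail v hx)
      simp only [List.map_cons] at h1 ⊢
      rw [cup_succ_cons_cons, cup_succ_cons_cons, h1, ha k v (by simp), ha k w (by simp)]
      have h2 : (1 : ZMod 2) + 1 = 0 := rfl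
      linear_combination cup θ k (Finsupp.single (w :: l) 1) * h2

lemma twist_add_push (θ : ℕ → V → ZMod 2) (a : V → V) (k : ℕ) {s : Set (List V)}
    {c : TupleChain V} (hc : c ∈ Finsupp.supported (ZMod 2) (ZMod 2) s)
    (ha : ∀ l ∈ s, ∀ i, ∀ x ∈ l, θ i (a x) = θ i x + 1) :
    twist (θ k) (cup θ k) (c + push a c) = cup θ k c := by
  refine map_eq_of_mem_supported
    (f := (twist (θ k) (cup θ k)).comp (LinearMap.id + push a)) hc fun l hl => ?_
  match l with
  | [] => simp [twist, cup_nil]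
  | v :: l =>
    have h1 := cup_single_map θ a (k := k) (ha _ hl)
    have h2 := ha _ hl k v (by simp)
    simp only [List.map_cons] at h1
    simp only [LinearMap.comp_apply, LinearMap.add_apply, LinearMap.id_apply, push_single,
      List.map_cons, map_add, twist, Finsupp.linearCombination_single, one_smul, h1, h2]
    have h3 := CharTwo.add_self_eq_zero (θ k v)
    linear_combination cup θ k (Finsupp.single (v :: l) 1) * h3

/-- Sweeping a cycle through a sequence of maps. -/
lemma boundary_sum_prism (h : ℕ → V → W) {z : TupleChain V} (hz : boundary z = 0) (M : ℕ) :
    boundary (∑ j ∈ Finset.range M, prism (h j) (h (j + 1)) z) = push (h M) z + push (h 0) z := by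
  induction M with
  | zero => simp [add_self]
  | succ M ih =>
    rw [Finset.sum_range_succ, map_add, ih, boundary_prism, hz, map_zero, add_zero]
    have := add_self (push (h M) z)
    calc _ = push (h (M + 1)) z + push (h 0) z + (push (h M) z + push (h M) z) := by abel
      _ = _ := by rw [this, add_zero]

end TupleChain

section BorsukUlam

variable {V : Type*} [NormedAddCommGroup V] [NormedSpace ℝ V]

/-- The tuples of points of `S` of diameter less than `δ`. -/
def smallTuples (S : Set V) (δ : ℝ) : Set (List V) :=
  {l | ∀ x ∈ l, x ∈ S ∧ ∀ y ∈ l, dist x y < δ}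

open TupleChain in
/-- Arbitrarily fine hemispheres: a compact symmetric set avoiding the origin in a subspace of
dimension `k + 1` carries fine `k`-chains on which the `k`-fold cup product does not vanish. -/
lemma exists_fine_hemisphere (θ : ℕ → V → ZMod 2)
    (hθ : ∀ i x, x ≠ 0 → θ i (-x) = θ i x + 1) (k : ℕ) (hk : k < Module.finrank ℝ V) :
    ∃ (S : Set V) (U : Submodule ℝ V), IsCompact S ∧ (∀ x ∈ S, -x ∈ S) ∧ (0 : V) ∉ S ∧
      S ⊆ U ∧ Module.finrank ℝ U ≤ k + 1 ∧ FiniteDimensional ℝ U ∧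
      ∀ δ > 0, ∃ c ∈ Finsupp.supported (ZMod 2) (ZMod 2) (smallTuples S δ),
        boundary (c + push Neg.neg c) = 0 ∧ cup θ k c = 1 := by
  induction k with
  | zero =>
    have : Nontrivial V := Module.nontrivial_of_finrank_pos hk
    obtain ⟨e, he⟩ := exists_ne (0 : V)
    refine ⟨{e, -e}, ℝ ∙ e, (Set.toFinite _).isCompact, ?_, ?_, ?_, ?_, inferInstance, ?_⟩
    · rintro x (rfl | rfl) <;> simp
    · simp [he.symm, he]
    · rintro x (rfl | rfl)
      · exact Submodule.mem_span_singleton_self _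
      · exact neg_mem (Submodule.mem_span_singleton_self _)
    · simpa using (finrank_span_singleton he).le
    · intro δ hδ
      refine ⟨Finsupp.single [e] 1, Finsupp.single_mem_supported _ _ ?_, ?_, ?_⟩
      · simp [smallTuples, hδ]
      · simp [listBoundary, add_self]
      · exact cup_zero_singleton θ e
  | succ k ih =>
    obtain ⟨S, U, hSc, hSn, hS0, hSU, hU, hUf, hS⟩ := ih (by omega)
    obtain ⟨e, heU⟩ : ∃ e, e ∉ U := by
      by_contra! h
      have : U = ⊤ := by ext; simp [h]
      rw [this, finrank_top] at hU
      omega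
    let H : ℝ → V → V := fun t x => (1 - t) • x + t • e
    let I : Set V := (fun p : ℝ × V => H p.1 p.2) '' (Set.Icc 0 1 ×ˢ S)
    have hIc : IsCompact I := (isCompact_Icc.prod hSc).image (by fun_prop)
    have hI0 : (0 : V) ∉ I := by
      rintro ⟨⟨t, x⟩, ⟨-, hx⟩, h⟩
      simp only [H] at h hx
      have hte : t = 0 := by
        by_contra ht
        apply heU
        have : t • e ∈ U := by
          rw [eq_neg_of_add_eq_zero_right h]
          exact neg_mem (U.smul_mem _ (hSU hx))
        exact (U.smul_mem_iff ht).1 this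
      subst hte
      apply hS0
      simp at h
      rwa [← h]
    have hIU : I ⊆ (U ⊔ (ℝ ∙ e) : Submodule ℝ V) := by
      rintro _ ⟨⟨t, x⟩, ⟨-, hx⟩, rfl⟩
      exact Submodule.add_mem_sup (U.smul_mem _ (hSU hx))
        (Submodule.smul_mem _ _ (Submodule.mem_span_singleton_self e))
    refine ⟨I ∪ -I, U ⊔ (ℝ ∙ e), hIc.union hIc.neg, ?_, ?_, ?_, ?_, inferInstance, ?_⟩
    · rintro x (hx | hx)
      · right; simpa using hx
      · left; exact hx
    · simpa using hI0
    · refine Set.union_subset hIU fun x hx => ?_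
      have := neg_mem (hIU hx)
      simpa using this
    · have h1 := Submodule.finrank_add_le_finrank_add_finrank U (ℝ ∙ e)
      have h2 : Module.finrank ℝ (ℝ ∙ e) ≤ 1 := by
        simpa using finrank_span_le_card (R := ℝ) ({e} : Set V)
      omega
    · intro δ hδ
      obtain ⟨c, hcS, hc, hcup⟩ := hS (δ / 2) (half_pos hδ)
      obtain ⟨R, hR⟩ : ∃ R, ∀ x ∈ S, ‖x - e‖ ≤ R := by
        obtain ⟨R, hR⟩ := hSc.isBounded.exists_norm_le
        exact ⟨R + ‖e‖, fun x hx => (norm_sub_le _ _).trans (by gcongr; exact hR x hx)⟩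
      obtain ⟨M, hM⟩ := exists_nat_gt (2 * R / δ)
      have hMpos : (0 : ℝ) < M + 1 := by positivity
      let z := c + push Neg.neg c
      have hz : z ∈ Finsupp.supported (ZMod 2) (ZMod 2) (smallTuples S (δ / 2)) := by
        refine Submodule.add_mem _ hcS (map_mem_supported hcS fun l hl => ?_)
        rw [push_single]
        refine Finsupp.single_mem_supported _ _ ?_
        simp only [smallTuples, Set.mem_ofPred_eq, List.mem_map] at hl ⊢
        rintro _ ⟨x, hx, rfl⟩
        refine ⟨hSn x (hl x hx).1, ?_⟩
        rintro _ ⟨y, hy, rfl⟩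
        rw [dist_neg_neg]
        exact (hl x hx).2 y hy
      let h : ℕ → V → V := fun j => H (j / (M + 1))
      let c' := ∑ j ∈ Finset.range (M + 1), prism (h j) (h (j + 1)) z
      have hbd : boundary c' = z := by
        have h0 : h 0 = id := by ext; simp [h, H]
        have h1 : h (M + 1) = fun _ => e := by
          ext
          simp [h, H, div_self hMpos.ne']
        rw [boundary_sum_prism h hc, h0, h1, push_id]
        have : push (fun _ : V => e) z = 0 := by
          simp only [z, map_add, push_push]
          exact add_self _
        rw [this, zero_add]
      have hne : ∀ l ∈ smallTuples S (δ / 2), ∀ i, ∀ x ∈ l, θ i (-x) = θ i x + 1 := by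
        intro l hl i x hx
        exact hθ i x fun h0 => hS0 (h0 ▸ (hl x hx).1)
      refine ⟨c', Submodule.sum_mem _ fun j hj => ?_, ?_, ?_⟩
      · rw [Finset.mem_range] at hj
        refine map_mem_supported hz fun l hl => ?_
        rw [prism_single]
        refine Finsupp.supported_mono ?_ (listPrism_mem_supported _ _ l)
        have hparam : ∀ x ∈ {x | ∃ v ∈ l, x = h j v ∨ x = h (j + 1) v}, ∃ v ∈ l, ∃ t : ℝ,
            x = H t v ∧ 0 ≤ t ∧ j / (M + 1) ≤ t ∧ t ≤ (j + 1) / (M + 1) ∧ t ≤ 1 := by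
          have hj1 : ((j : ℝ) + 1) / (M + 1) ≤ 1 := by
            rw [div_le_one hMpos]
            exact_mod_cast hj
          have hj2 : (j : ℝ) / (M + 1) ≤ (j + 1) / (M + 1) := by gcongr; linarith
          rintro x ⟨v, hv, rfl | rfl⟩
          · exact ⟨v, hv, j / (M + 1), rfl, by positivity, le_rfl, hj2, hj2.trans hj1⟩
          · exact ⟨v, hv, (j + 1) / (M + 1), by simp [h], by positivity, hj2, le_rfl, hj1⟩
        intro t ht x hx
        obtain ⟨v, hv, s, rfl, hs0, hs1, hs2, hs3⟩ := hparam x (ht x hx)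
        refine ⟨.inl ⟨(s, v), ⟨⟨hs0, hs3⟩, (hl v hv).1⟩, rfl⟩, fun y hy => ?_⟩
        obtain ⟨w, hw, s', rfl, hs0', hs1', hs2', hs3'⟩ := hparam y (ht y hy)
        have hdiff : H s v - H s' w = (1 - s) • (v - w) + (s' - s) • (w - e) := by
          simp only [H]; module
        have hss : |s' - s| ≤ 1 / (M + 1) := by
          rw [add_div] at hs2 hs2'
          rw [abs_le]; constructor <;> linarith
        have hvw : ‖v - w‖ < δ / 2 := by
          rw [← dist_eq_norm]; exact (hl v hv).2 w hw
        have hwe := hR w (hl w hw).1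
        have hMR : 1 / (M + 1) * R < δ / 2 := by
          rw [div_lt_iff₀ hδ] at hM
          rw [one_div_mul_eq_div, div_lt_iff₀ hMpos]
          nlinarith
        rw [dist_eq_norm, hdiff]
        calc _ ≤ |1 - s| * ‖v - w‖ + |s' - s| * ‖w - e‖ := by
              simpa [norm_smul] using norm_add_le ((1 - s) • (v - w)) ((s' - s) • (w - e))
          _ ≤ 1 * ‖v - w‖ + 1 / (M + 1) * R := by
              gcongr
              rw [abs_le]; constructor <;> linarith
          _ < δ := by linarith
      · rw [map_add, boundary_push, hbd]
        simp only [z, map_add, push_push]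
        have : (Neg.neg ∘ Neg.neg : V → V) = id := by ext; simp
        rw [this, push_id, add_comm (push Neg.neg c) c]
        exact add_self _
      · rw [cup, LinearMap.comp_apply, hbd, twist_add_push θ Neg.neg k hcS hne, hcup]

/-- **Borsuk–Ulam theorem**: an odd map to a space of smaller dimension which is continuous away
from the origin has a nontrivial zero. -/
theorem exists_ne_zero_eq_zero_of_odd {n : ℕ} (hn : n < Module.finrank ℝ V)
    {f : V → Fin n → ℝ} (hf : ContinuousOn f {0}ᶜ) (hodd : ∀ x, f (-x) = -f x) :
    ∃ x ≠ 0, f x = 0 := by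
  classical
  by_contra! hne
  let s : V → ZMod 2 := fun x => if WellOrderingRel x (-x) then 1 else 0
  have hs : ∀ x, x ≠ 0 → s (-x) = s x + 1 := by
    intro x hx
    have hxx : x ≠ -x := fun h => hx (by
      have : (2 : ℝ) • x = 0 := by rw [two_smul]; nth_rewrite 1 [h]; exact neg_add_cancel x
      simpa using this)
    have h2 : (1 : ZMod 2) + 1 = 0 := rfl
    rcases trichotomous_of WellOrderingRel x (-x) with h | h | h
    · simp [s, h, asymm_of WellOrderingRel h, h2]
    · exact absurd h hxx
    · simp [s, h, asymm_of WellOrderingRel h]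
  let g : ℕ → V → ℝ := fun i x => if h : i < n then f x ⟨i, h⟩ else 0
  have hg : ∀ i x, g i (-x) = - g i x := by
    intro i x
    by_cases h : i < n <;> simp [g, h, hodd]
  let θ : ℕ → V → ZMod 2 := fun i x => if 0 < g i x then 1 else if g i x < 0 then 0 else s x
  have hθ : ∀ i x, x ≠ 0 → θ i (-x) = θ i x + 1 := by
    intro i x hx
    have h2 : (1 : ZMod 2) + 1 = 0 := rfl
    rcases lt_trichotomy (g i x) 0 with h | h | h
    · simp [θ, hg, h, h.not_gt]
    · simp [θ, hg, h, hs x hx]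
    · simp [θ, hg, h, h.not_gt, h2]
  obtain ⟨S, -, hSc, -, hS0, -, -, -, hS⟩ := exists_fine_hemisphere θ hθ n hn
  have hfS : ContinuousOn f S := hf.mono fun x hx h0 => hS0 (h0 ▸ hx)
  obtain ⟨ε, hε, hεS⟩ : ∃ ε > 0, ∀ x ∈ S, ε ≤ ‖f x‖ := by
    rcases S.eq_empty_or_nonempty with rfl | hSne
    · exact ⟨1, one_pos, by simp⟩
    · obtain ⟨x, hx, hmin⟩ := hSc.exists_isMinOn hSne hfS.norm
      exact ⟨‖f x‖, norm_pos_iff.2 (hne x fun h0 => hS0 (h0 ▸ hx)), fun y hy => hmin hy⟩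
  obtain ⟨δ, hδ, hδS⟩ :=
    Metric.uniformContinuousOn_iff.1 (hSc.uniformContinuousOn_of_continuous hfS) ε hε
  obtain ⟨c, hc, -, hcup⟩ := hS δ hδ
  have h0 : TupleChain.cup θ n c = 0 := by
    refine TupleChain.map_eq_of_mem_supported (g := 0) hc fun l hl => ?_
    simp only [LinearMap.zero_apply]
    match l with
    | [] => exact TupleChain.cup_nil θ n
    | x :: l =>
      have hx := (hl x (by simp)).1
      obtain ⟨i, hi⟩ : ∃ i, ε ≤ |f x i| := by
        by_contra! h
        exact (hεS x hx).not_gt ((pi_norm_lt_iff hε).2 h)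
      refine TupleChain.cup_single_eq_zero θ i.2 ?_
      have key : ∀ y ∈ x :: l, θ i y = if 0 < f x i then 1 else 0 := by
        intro y hy
        have hd := hδS x hx y (hl y hy).1 ((hl x (by simp)).2 y hy)
        have hd' : |f x i - f y i| < ε := (dist_le_pi_dist (f x) (f y) i).trans_lt hd
        have hgy : g i y = f y i := by simp [g]
        rw [abs_lt] at hd'
        simp only [θ, hgy]
        rcases le_abs.1 hi with h | h
        · rw [if_pos (by linarith), if_pos (by linarith)]
        · rw [if_neg (by linarith), if_pos (by linarith), if_neg (by linarith)]
      intro y hy w hw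
      rw [key y hy, key w hw]
  rw [hcup] at h0
  exact one_ne_zero h0

end BorsukUlam

section Subspaces

variable {X : Type*} [NormedAddCommGroup X] [NormedSpace ℝ X]

/-- **Krein–Krasnoselskii–Milman theorem**: a finite dimensional subspace `G` with
`dim F < dim G` contains a unit vector at distance `1` from `F`. -/
theorem exists_norm_eq_one_forall_le_norm_sub (G F : Submodule ℝ X) [FiniteDimensional ℝ G]
    [FiniteDimensional ℝ F] (hFG : Module.finrank ℝ F < Module.finrank ℝ G) :
    ∃ g ∈ G, ‖g‖ = 1 ∧ ∀ f ∈ F, 1 ≤ ‖g - f‖ := by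
  classical
  by_contra! hcon
  obtain ⟨t, ht⟩ := (isCompact_sphere (0 : G) 1).elim_finite_subcover
    (fun f : F => {g : G | ‖(g : X) - f‖ < 1})
    (fun f => isOpen_lt (by fun_prop) continuous_const) (by
      intro g hg
      obtain ⟨f, hf, hgf⟩ := hcon g g.2 (by simpa using hg)
      exact Set.mem_iUnion.2 ⟨⟨f, hf⟩, hgf⟩)
  let Q : Finset F := t ∪ t.image Neg.neg
  have hQ : ∀ f ∈ Q, -f ∈ Q := by
    intro f hf
    simp only [Q, Finset.mem_union, Finset.mem_image] at hf ⊢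
    rcases hf with hf | ⟨f', hf', rfl⟩
    · exact .inr ⟨f, hf, rfl⟩
    · left; simpa using hf'
  let w : G → F → ℝ := fun g f => max 0 (1 - ‖(g : X) - f‖)
  have hw : ∀ g f, w (-g) (-f) = w g f := by
    intro g f
    have : ((-g : G) : X) - (-f : F) = -((g : X) - f) := by push_cast; abel
    simp only [w, this, norm_neg]
  let p : G → F := fun g => ∑ f ∈ Q, w g f • f
  have hp : ∀ g, p (-g) = - p g := by
    intro g
    simp only [p, ← Finset.sum_neg_distrib]
    refine Finset.sum_nbij' Neg.neg Neg.neg hQ hQ (by simp) (by simp) fun f _ => ?_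
    rw [← hw g (-f), neg_neg, smul_neg, neg_neg]
  have hpc : Continuous p := by
    simp only [p, w]
    fun_prop
  let b := Module.finBasis ℝ F
  have hbc : Continuous b.equivFun := b.equivFun.toLinearMap.continuous_of_finiteDimensional
  obtain ⟨x, hx0, hx⟩ := exists_ne_zero_eq_zero_of_odd hFG
    (f := fun x : G => b.equivFun (p (‖x‖⁻¹ • x)))
    (by
      refine hbc.comp_continuousOn (hpc.comp_continuousOn ?_)
      exact (continuous_norm.continuousOn.inv₀ fun x hx => norm_ne_zero_iff.2 hx).smul
        continuousOn_id)
    (fun x => by rw [norm_neg, smul_neg, hp, map_neg])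
  have hpz : p (‖x‖⁻¹ • x) = 0 := by simpa using hx
  set g := ‖x‖⁻¹ • x with hg
  have hg1 : ‖g‖ = 1 := by
    rw [hg, norm_smul, norm_inv, norm_norm, inv_mul_cancel₀ (norm_ne_zero_iff.2 hx0)]
  obtain ⟨f₀, hf₀, hgf₀⟩ : ∃ f ∈ t, ‖(g : X) - f‖ < 1 := by
    simpa using ht (show g ∈ sphere (0 : G) 1 by simpa using hg1)
  have hw0 : ∀ f, 0 ≤ w g f := fun f => le_max_left _ _
  have hsum : (∑ f ∈ Q, w g f) • (g : X) = ∑ f ∈ Q, w g f • ((g : X) - f) := by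
    have : ((p g : F) : X) = 0 := by rw [hpz]; rfl
    simp only [p, Submodule.coe_sum, Submodule.coe_smul] at this
    simp only [smul_sub, Finset.sum_sub_distrib, this, sub_zero, Finset.sum_smul]
  have hle : ∑ f ∈ Q, w g f ≤ ∑ f ∈ Q, w g f * ‖(g : X) - f‖ := by
    have h1 : ‖(g : X)‖ = 1 := hg1
    calc ∑ f ∈ Q, w g f = ‖(∑ f ∈ Q, w g f) • (g : X)‖ := by
          rw [norm_smul, h1, mul_one, Real.norm_of_nonneg (Finset.sum_nonneg fun f _ => hw0 f)]
      _ ≤ ∑ f ∈ Q, ‖w g f • ((g : X) - f)‖ := by rw [hsum]; exact norm_sum_le _ _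
      _ = _ := by simp only [norm_smul, Real.norm_of_nonneg (hw0 _)]
  refine hle.not_gt (Finset.sum_lt_sum (fun f _ => ?_) ⟨f₀, by simp [Q, hf₀], ?_⟩)
  · rcases le_total ‖(g : X) - f‖ 1 with h | h
    · exact mul_le_of_le_one_right (hw0 f) h
    · have : w g f = 0 := max_eq_left (by linarith)
      simp [this]
  · have : 0 < w g f₀ := lt_max_of_lt_right (by linarith)
    exact mul_lt_of_lt_one_right this hgf₀

/-- Mazur's lemma: an infinite dimensional subspace contains an infinite dimensional subspace
which is uniformly transversal to a given finite dimensional one. -/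
lemma exists_infinite_dimensional_norm_le (F Y : Submodule ℝ X) [FiniteDimensional ℝ F]
    (hY : ¬ FiniteDimensional ℝ Y) :
    ∃ Z ≤ Y, ¬ FiniteDimensional ℝ Z ∧ ∀ z ∈ Z, ∀ f ∈ F, ‖z‖ ≤ 3 * ‖z - f‖ := by
  obtain ⟨t, ht⟩ := (isCompact_sphere (0 : F) 1).elim_finite_subcover
    (fun φ : {φ : X →L[ℝ] ℝ // ‖φ‖ ≤ 1} => {f : F | 1 / 2 < φ.1 f})
    (fun φ => isOpen_lt continuous_const (by fun_prop)) (by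
      intro f hf
      have hf1 : ‖(f : X)‖ = 1 := by simpa using hf
      obtain ⟨φ, hφ, hφf⟩ := exists_dual_vector ℝ (f : X) (by
        rw [← norm_ne_zero_iff, hf1]; norm_num)
      refine Set.mem_iUnion.2 ⟨⟨φ, hφ.le⟩, ?_⟩
      simp only [Set.mem_ofPred_eq, hφf, hf1]
      norm_num)
  let L : Y →ₗ[ℝ] (t → ℝ) := LinearMap.pi fun φ => φ.1.1.toLinearMap.comp Y.subtype
  refine ⟨L.ker.map Y.subtype, Submodule.map_subtype_le _ _, fun h => hY ?_, ?_⟩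
  · have : FiniteDimensional ℝ L.ker :=
      (Submodule.equivSubtypeMap Y L.ker).symm.finiteDimensional
    have : FiniteDimensional ℝ (Y ⧸ L.ker) := L.quotKerEquivRange.symm.finiteDimensional
    exact Module.Finite.of_submodule_quotient L.ker
  · rintro _ ⟨z, hz, rfl⟩ f hf
    have hz' : ∀ φ ∈ t, φ.1 (z : X) = 0 := fun φ hφ => congr_fun (LinearMap.mem_ker.1 hz) ⟨φ, hφ⟩
    have hfz : ‖f‖ ≤ 2 * ‖(z : X) - f‖ := by
      rcases eq_or_ne f 0 with rfl | hf0
      · simp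
      have hfn : 0 < ‖f‖ := norm_pos_iff.2 hf0
      have hmem : (‖f‖⁻¹ • ⟨f, hf⟩ : F) ∈ sphere (0 : F) 1 := by
        simp [norm_smul, hfn.ne']
      obtain ⟨φ, hφt, hφ⟩ := Set.mem_iUnion₂.1 (ht hmem)
      have h1 : 1 / 2 < ‖f‖⁻¹ * φ.1 f := by simpa using hφ
      rw [inv_mul_eq_div, lt_div_iff₀ hfn] at h1
      have h2 : φ.1 f = φ.1 (f - z) := by rw [map_sub, hz' φ hφt, sub_zero]
      have h3 : φ.1 (f - z) ≤ 1 * ‖f - (z : X)‖ :=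
        (le_abs_self _).trans (φ.1.le_of_opNorm_le φ.2 _)
      rw [norm_sub_rev] at h3
      linarith
    have := norm_le_norm_sub_add (z : X) f
    simp only [Submodule.subtype_apply]
    linarith

/-- A copy of `ℓ¹(m)` in `Y` with distortion depending only on `m`, even modulo `H`. -/
lemma exists_linearMap_sum_abs_le (Y : Submodule ℝ X) (hY : ¬ FiniteDimensional ℝ Y) (m : ℕ)
    (H : Submodule ℝ X) [FiniteDimensional ℝ H] :
    ∃ S : (Fin m → ℝ) →ₗ[ℝ] X, (∀ x, S x ∈ Y) ∧ (∀ x, ‖S x‖ ≤ ∑ i, |x i|) ∧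
      ∀ x, ∀ h ∈ H, ∑ i, |x i| ≤ 7 ^ m * ‖S x - h‖ := by
  induction m with
  | zero => exact ⟨0, by simp, by simp, by simp⟩
  | succ m ih =>
    obtain ⟨S, hSY, hS, hSH⟩ := ih
    obtain ⟨Z, hZY, hZ, hZH⟩ := exists_infinite_dimensional_norm_le (H ⊔ S.range) Y hY
    obtain ⟨z, hzZ, hz⟩ : ∃ z ∈ Z, z ≠ 0 := by
      refine Z.exists_mem_ne_zero_of_ne_bot ?_
      rintro rfl
      exact hZ inferInstance
    let e := ‖z‖⁻¹ • z
    have heZ : e ∈ Z := Z.smul_mem _ hzZ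
    have he : ‖e‖ = 1 := by
      rw [norm_smul, norm_inv, norm_norm, inv_mul_cancel₀ (norm_ne_zero_iff.2 hz)]
    let S' : (Fin (m + 1) → ℝ) →ₗ[ℝ] X :=
      S.comp (LinearMap.funLeft ℝ ℝ Fin.castSucc) +
        (LinearMap.proj (Fin.last m) : (Fin (m + 1) → ℝ) →ₗ[ℝ] ℝ).smulRight e
    have hS' : ∀ x, S' x = S (fun i => x i.castSucc) + x (Fin.last m) • e := fun x => rfl
    refine ⟨S', fun x => ?_, fun x => ?_, fun x h hh => ?_⟩
    · exact add_mem (hSY _) (Y.smul_mem _ (hZY heZ))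
    · rw [hS', Fin.sum_univ_castSucc]
      refine (norm_add_le _ _).trans (add_le_add (hS _) ?_)
      rw [norm_smul, he, mul_one, Real.norm_eq_abs]
    · rw [hS', Fin.sum_univ_castSucc]
      set v := S (fun i => x i.castSucc) with hv
      set r := x (Fin.last m)
      have h1 : |r| ≤ 3 * ‖v + r • e - h‖ := by
        have := hZH (r • e) (Z.smul_mem _ heZ) (h - v) (sub_mem (Submodule.mem_sup_left hh)
          (Submodule.mem_sup_right ⟨_, rfl⟩))
        rwa [norm_smul, he, mul_one, Real.norm_eq_abs,
          show r • e - (h - v) = v + r • e - h by abel] at this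
      have h2 : ‖v - h‖ ≤ ‖v + r • e - h‖ + |r| := by
        have := norm_sub_le (v + r • e - h) (r • e)
        rwa [norm_smul, he, mul_one, Real.norm_eq_abs,
          show v + r • e - h - r • e = v - h by abel] at this
      have h3 := hSH (fun i => x i.castSucc) h hh
      have h4 : (1 : ℝ) ≤ 7 ^ m := one_le_pow₀ (by norm_num)
      rw [← hv] at h3
      set d := ‖v + r • e - h‖
      have hd : 0 ≤ d := norm_nonneg _
      have h5 : (7 : ℝ) ^ m * ‖v - h‖ ≤ 7 ^ m * (4 * d) := by gcongr; linarith
      rw [pow_succ]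
      nlinarith

/-- An `m`-dimensional subspace of `Y` whose distances to a sequence of finite dimensional
subspaces decay at most geometrically, with a rate depending only on `m`. -/
lemma exists_submodule_geometric_le [CompleteSpace X] (Y : Submodule ℝ X)
    (hYc : IsClosed (Y : Set X)) (hY : ¬ FiniteDimensional ℝ Y) (m : ℕ)
    (B : ℕ → Submodule ℝ X) (hB : ∀ k, FiniteDimensional ℝ (B k)) :
    ∃ G ≤ Y, FiniteDimensional ℝ G ∧ Module.finrank ℝ G = m ∧
      (∀ g ∈ G, ∀ h ∈ B 0, ‖g‖ ≤ 8 * ‖g - h‖) ∧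
      ∀ g ∈ G, ∀ k, ∀ h ∈ B k, (1 / (16 * 7 ^ m)) ^ (k + 1) * ‖g‖ ≤ ‖g - h‖ := by
  have hex : ∀ H : Submodule ℝ X, FiniteDimensional ℝ H → ∃ S : (Fin m → ℝ) →ₗ[ℝ] X,
      (∀ x, S x ∈ Y) ∧ (∀ x, ‖S x‖ ≤ ∑ i, |x i|) ∧
      (∀ x, ∀ h ∈ H, ∑ i, |x i| ≤ 7 ^ m * ‖S x - h‖) ∧ ∀ x, ∀ h ∈ H, ‖S x‖ ≤ 3 * ‖S x - h‖ := by
    intro H hH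
    obtain ⟨Z, hZY, hZ, hZH⟩ := exists_infinite_dimensional_norm_le H Y hY
    obtain ⟨S, hSZ, hS, hSH⟩ := exists_linearMap_sum_abs_le Z hZ m H
    exact ⟨S, fun x => hZY (hSZ x), hS, hSH, fun x => hZH _ (hSZ x)⟩
  choose! S hSY hS hSH hS3 using hex
  obtain ⟨D, hD0, hDsucc⟩ : ∃ D : ℕ → Submodule ℝ X,
      D 0 = ⊥ ∧ ∀ k, D (k + 1) = D k ⊔ (S (D k ⊔ B k)).range :=
    ⟨fun k => Nat.rec ⊥ (fun k D => D ⊔ (S (D ⊔ B k)).range) k, rfl, fun k => rfl⟩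
  have hD : ∀ k, FiniteDimensional ℝ ↥(D k) := by
    intro k
    induction k with
    | zero => rw [hD0]; infer_instance
    | succ k ih => rw [hDsucc]; infer_instance
  have hDB : ∀ k, FiniteDimensional ℝ ↥(D k ⊔ B k) := fun k => inferInstance
  have hDmono : Monotone D := monotone_nat_of_le_succ fun k => by rw [hDsucc]; exact le_sup_left
  let s : ℕ → (Fin m → ℝ) →ₗ[ℝ] X := fun k => S (D k ⊔ B k)
  have hsD : ∀ j k, j < k → ∀ x, s j x ∈ D k := fun j k hjk x =>
    hDmono (Nat.succ_le_of_lt hjk) (by rw [hDsucc]; exact Submodule.mem_sup_right ⟨x, rfl⟩)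
  set C : ℝ := 7 ^ m with hC
  have hC1 : 1 ≤ C := one_le_pow₀ (by norm_num)
  set a : ℝ := 1 / (16 * C) with ha
  have ha0 : 0 < a := by positivity
  have ha16 : a ≤ 1 / 16 := by
    rw [ha]; gcongr; linarith
  have haC : a * (16 * C) = 1 := by rw [ha]; field_simp
  let N : (Fin m → ℝ) → ℝ := fun x => ∑ i, |x i|
  have hN : ∀ x, 0 ≤ N x := fun x => Finset.sum_nonneg fun i _ => abs_nonneg _
  let u : (Fin m → ℝ) → ℕ → X := fun x k => a ^ k • s k x
  have hu : ∀ x k, ‖u x k‖ ≤ N x * a ^ k := by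
    intro x k
    rw [norm_smul, Real.norm_of_nonneg (by positivity), mul_comm]
    gcongr
    exact hS _ (hDB k) x
  have hsum : ∀ x, Summable (u x) := fun x => .of_norm_bounded
    ((summable_geometric_of_lt_one ha0.le (by linarith)).mul_left (N x)) (hu x)
  let T : (Fin m → ℝ) →ₗ[ℝ] X :=
    { toFun := fun x => ∑' k, u x k
      map_add' := fun x y => by
        rw [← (hsum x).tsum_add (hsum y)]
        simp [u]
      map_smul' := fun r x => by
        rw [RingHom.id_apply, ← (hsum x).tsum_const_smul]
        exact tsum_congr fun k => by simp only [u, map_smul]; rw [smul_comm] }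
  let P : (Fin m → ℝ) → ℕ → X := fun x k => ∑ j ∈ Finset.range k, u x j
  have hPT : ∀ x, Tendsto (P x) atTop (nhds (T x)) := fun x => (hsum x).hasSum.tendsto_sum_nat
  have htail : ∀ x k, ‖P x k - T x‖ ≤ 2 * (a ^ k * N x) := by
    intro x k
    have := dist_le_of_le_geometric_of_tendsto a (N x) (by linarith) (f := P x) (fun j => by
      rw [dist_eq_norm, norm_sub_rev]
      simpa [P, Finset.sum_range_succ] using hu x j) (hPT x) k
    rw [dist_eq_norm] at this
    refine this.trans ?_
    rw [div_le_iff₀ (by linarith)]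
    have : 0 ≤ N x * a ^ k := mul_nonneg (hN x) (by positivity)
    nlinarith
  have hTN : ∀ x, ‖T x‖ ≤ 2 * N x := fun x => by simpa [P] using htail x 0
  have hPD : ∀ x k, P x k ∈ D k := fun x k => Submodule.sum_mem _ fun j hj =>
    (D k).smul_mem _ (hsD j k (Finset.mem_range.1 hj) x)
  have hlow : ∀ x k, ∀ h ∈ B k, 14 * (a ^ (k + 1) * N x) ≤ ‖T x - h‖ := by
    intro x k h hh
    have hak : 0 < a ^ k := by positivity
    have h1 := hSH _ (hDB k) x ((a ^ k)⁻¹ • (h - P x k)) (Submodule.smul_mem _ _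
      (sub_mem (Submodule.mem_sup_right hh) (Submodule.mem_sup_left (hPD x k))))
    have h2 : P x (k + 1) - h = a ^ k • (s k x - (a ^ k)⁻¹ • (h - P x k)) := by
      rw [smul_sub, smul_inv_smul₀ hak.ne']
      simp only [P, Finset.sum_range_succ, u]
      abel
    have h3 : a ^ k * N x ≤ C * ‖P x (k + 1) - h‖ := by
      rw [h2, norm_smul, Real.norm_of_nonneg hak.le, mul_left_comm]
      gcongr
    have h4 := htail x (k + 1)
    have h5 : ‖P x (k + 1) - h‖ ≤ ‖T x - h‖ + ‖P x (k + 1) - T x‖ := by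
      rw [add_comm ‖T x - h‖]; exact norm_sub_le_norm_sub_add_norm_sub _ _ _
    have h6 : 16 * (a ^ (k + 1) * N x) ≤ ‖P x (k + 1) - h‖ := by
      have := mul_le_mul_of_nonneg_left h3 (by positivity : 0 ≤ 16 * a)
      calc _ = 16 * a * (a ^ k * N x) := by ring
        _ ≤ _ := this
        _ = a * (16 * C) * ‖P x (k + 1) - h‖ := by ring
        _ = _ := by rw [haC, one_mul]
    linarith
  have hTinj : Function.Injective T := by
    rw [← LinearMap.ker_eq_bot, LinearMap.ker_eq_bot']
    intro x hx
    have h1 := hlow x 0 0 (zero_mem _)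
    rw [hx, sub_zero, norm_zero, zero_add, pow_one] at h1
    have h2 : N x = 0 := le_antisymm (by nlinarith) (hN x)
    ext i
    exact abs_eq_zero.1 ((Finset.sum_eq_zero_iff_of_nonneg fun i _ => abs_nonneg _).1 h2 i
      (Finset.mem_univ i))
  refine ⟨T.range, ?_, inferInstance, ?_, ?_, ?_⟩
  · rintro _ ⟨x, rfl⟩
    exact hYc.mem_of_tendsto (hPT x) (.of_forall fun k => Submodule.sum_mem _ fun j _ =>
      Y.smul_mem _ (hSY _ (hDB j) x))
  · rw [LinearMap.finrank_range_of_inj hTinj, Module.finrank_fin_fun]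
  · rintro _ ⟨x, rfl⟩ h hh
    have hP1 : P x 1 = s 0 x := by simp [P, u]
    have h1 := htail x 1
    have h2 : N x ≤ C * ‖s 0 x - 0‖ := hSH _ (hDB 0) x 0 (zero_mem _)
    have h3 : ‖s 0 x‖ ≤ 3 * ‖s 0 x - h‖ := hS3 _ (hDB 0) x h (Submodule.mem_sup_right hh)
    rw [sub_zero] at h2
    rw [hP1, pow_one] at h1
    have h4 : 16 * (a * N x) ≤ ‖s 0 x‖ := by
      have := mul_le_mul_of_nonneg_left h2 (by positivity : 0 ≤ 16 * a)
      calc _ = 16 * a * N x := by ring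
        _ ≤ _ := this
        _ = a * (16 * C) * ‖s 0 x‖ := by ring
        _ = _ := by rw [haC, one_mul]
    have h5 := norm_sub_le_norm_sub_add_norm_sub (s 0 x) (T x) h
    have h6 : ‖T x‖ ≤ ‖s 0 x‖ + ‖s 0 x - T x‖ := by
      have := norm_sub_le (s 0 x) (s 0 x - T x)
      rwa [sub_sub_cancel] at this
    linarith [norm_nonneg (s 0 x)]
  · rintro _ ⟨x, rfl⟩ k h hh
    have h1 := hlow x k h hh
    have hak : 0 ≤ a ^ (k + 1) := by positivity
    have h2 := mul_le_mul_of_nonneg_left (hTN x) hak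
    have h3 := mul_nonneg hak (hN x)
    linarith

end Subspaces

/-- Bernstein's Lethargy Theorem for subspaces: if `{0} = A 0 ⊆ A 1 ⊆ ⋯` is an increasing
sequence of finite dimensional subspaces of a Banach space `X`, `Y` is an infinite
dimensional closed subspace of `X`, and `ε` is nonincreasing, nonnegative and tends to
`0`, then there is `y ∈ Y` with `‖y‖ = ε 0` and `E(y, A n) ≥ ε n` for every `n`. -/
theorem bernstein_lethargy_subspace
    {X : Type*} [NormedAddCommGroup X] [NormedSpace ℝ X] [CompleteSpace X]
    (A : ℕ → Submodule ℝ X) (hA0 : A 0 = ⊥) (hmono : Monotone A)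
    (hfd : ∀ n, FiniteDimensional ℝ (A n))
    (Y : Submodule ℝ X) (hYc : IsClosed (Y : Set X)) (hY : ¬ FiniteDimensional ℝ Y)
    (ε : ℕ → ℝ) (hnonneg : ∀ n, 0 ≤ ε n) (hanti : Antitone ε)
    (hlim : Tendsto ε atTop (nhds 0)) :
    ∃ y ∈ Y, ‖y‖ = ε 0 ∧ ∀ n : ℕ, ε n ≤ infDist y (A n : Set X) := by
  rcases (hnonneg 0).eq_or_lt with h0 | h0
  · refine ⟨0, Y.zero_mem, by simpa using h0, fun n => ?_⟩
    exact ((hanti n.zero_le).trans h0.ge).trans infDist_nonneg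
  have hev : ∀ r > 0, ∃ M, ∀ n ≥ M, ε n ≤ r := fun r hr =>
    eventually_atTop.1 ((hlim.eventually_lt_const hr).mono fun n hn => hn.le)
  obtain ⟨M₀, hM₀⟩ := hev (ε 0 / 8) (by positivity)
  let m := Module.finrank ℝ (A M₀) + 1
  have hM : ∀ k, ∃ M, k ≤ M ∧ ∀ n ≥ M, ε n ≤ (1 / (16 * 7 ^ m)) ^ (k + 1) * ε 0 := by
    intro k
    obtain ⟨M, hM⟩ := hev ((1 / (16 * 7 ^ m)) ^ (k + 1) * ε 0) (by positivity)
    exact ⟨max M k, le_max_right _ _, fun n hn => hM n ((le_max_left _ _).trans hn)⟩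
  choose M hkM hM using hM
  obtain ⟨G, hGY, hGf, hGm, hG0, hG⟩ :=
    exists_submodule_geometric_le Y hYc hY m (fun k => A (M (k + 1))) (fun k => hfd _)
  obtain ⟨g, hgG, hg1, hg⟩ := exists_norm_eq_one_forall_le_norm_sub G (A M₀) (by omega)
  have key : ∀ n, ∀ h ∈ A n, ε n ≤ ε 0 * ‖g - h‖ := by
    intro n h hh
    rcases le_total n M₀ with hn | hn
    · exact (hanti n.zero_le).trans (le_mul_of_one_le_right h0.le (hg h (hmono hn hh)))
    · classical
      have hex : ∃ k, n ≤ M (k + 1) := ⟨n, n.le_succ.trans (hkM _)⟩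
      have hk := Nat.find_spec hex
      have hmin := fun j => Nat.find_min hex (m := j)
      generalize Nat.find hex = k at hk hmin
      have hhk := hmono hk hh
      cases k with
      | zero =>
        have h1 := hG0 g hgG h hhk
        have h2 := hM₀ n hn
        rw [hg1] at h1
        nlinarith
      | succ j =>
        have h1 := hG g hgG (j + 1) h hhk
        have h2 := hM (j + 1) n (not_le.1 (hmin j j.lt_succ_self)).le
        rw [hg1, mul_one] at h1
        rw [mul_comm] at h2
        exact h2.trans (mul_le_mul_of_nonneg_left h1 h0.le)
  refine ⟨ε 0 • g, Y.smul_mem _ (hGY hgG), ?_, fun n => ?_⟩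
  · rw [norm_smul, hg1, mul_one, Real.norm_of_nonneg h0.le]
  · refine (le_infDist ⟨0, (A n).zero_mem⟩).2 fun h hh => ?_
    have h1 := key n ((ε 0)⁻¹ • h) ((A n).smul_mem _ hh)
    have h2 : ε 0 • g - h = ε 0 • (g - (ε 0)⁻¹ • h) := by
      rw [smul_sub, smul_inv_smul₀ h0.ne']
    rwa [dist_eq_norm, h2, norm_smul, Real.norm_of_nonneg h0.le]
end
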